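/- Let V be a finite-dimensional real vector space with a GCS given by a maximally isotropic complex subspace E ⊂ V_ℂ ⊕ V_ℂ* with E ∩ Ē = 0. The subspace ρ(E) ∩ ρ(Ē) of V_ℂ is stable under complex conjugation, hence equals S_ℂ for a unique real subspace S ⊆ V. Then: (i) S is a generalized complex subspace of V; (ii) the induced structure E_S satisfies E_S ∩ S_ℂ* = 0 (i.e. the induced GCS on S is B-symplectic); and (iii) every generalized complex subspace W ⊆ V whose induced structure satisfies E_W ∩ W_ℂ* = 0 is contained in S. Thus S is the unique maximal generalized complex subspace of V with B-symplectic induced structure. -/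

import Mathlib

open Module LinearMap TensorProduct

/-- The complexification `V_ℂ = ℂ ⊗_ℝ V`. -/
abbrev Cxf (V : Type*) [AddCommGroup V] [Module ℝ V] := ℂ ⊗[ℝ] V

section Conj

variable (V : Type*) [AddCommGroup V] [Module ℝ V]

/-- The complex conjugation on `V_ℂ = ℂ ⊗_ℝ V`. -/
noncomputable def conjC : Cxf V →ₗ[ℝ] Cxf V :=
  TensorProduct.map Complex.conjAe.toLinearMap LinearMap.id

lemma conjC_smul (c : ℂ) (x : Cxf V) :
    conjC V (c • x) = (starRingEnd ℂ c) • conjC V x := by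
  induction x using TensorProduct.induction_on with
  | zero => simp
  | tmul a v =>
      simp [conjC, TensorProduct.smul_tmul', map_mul, Complex.conjAe_coe]
  | add x y hx hy =>
      simp [smul_add, map_add, hx, hy]

/-- The conjugation induced on the complex dual of `V_ℂ`. -/
noncomputable def conjD : Module.Dual ℂ (Cxf V) →ₗ[ℝ] Module.Dual ℂ (Cxf V) where
  toFun f :=
    { toFun := fun x => starRingEnd ℂ (f (conjC V x))
      map_add' := by intro x y; simp [map_add]
      map_smul' := by intro c x; simp [conjC_smul, map_smul] }
  map_add' f g := by ext x; simp
  map_smul' r f := by ext x; simp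

/-- The conjugation on `V_ℂ ⊕ V_ℂ*`. -/
noncomputable def conjP :
    (Cxf V × Module.Dual ℂ (Cxf V)) →ₗ[ℝ] (Cxf V × Module.Dual ℂ (Cxf V)) :=
  LinearMap.prodMap (conjC V) (conjD V)

end Conj

section Pairing

variable (V : Type*) [AddCommGroup V] [Module ℝ V]

/-- The ℂ-bilinear extension of the standard pairing, on `V_ℂ ⊕ V_ℂ*`. -/
noncomputable def gcPairC (x y : Cxf V × Module.Dual ℂ (Cxf V)) : ℂ :=
  -(1/2) * (x.2 y.1 + y.2 x.1)

/-- A GCS on `V`, in terms of a maximally isotropic subspace `E ⊂ V_ℂ ⊕ V_ℂ*`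
with `E ∩ Ē = 0`. -/
noncomputable def IsGCSSub [FiniteDimensional ℝ V]
    (E : Submodule ℂ (Cxf V × Module.Dual ℂ (Cxf V))) : Prop :=
  (∀ x ∈ E, ∀ y ∈ E, gcPairC V x y = 0) ∧
  Module.finrank ℂ ↥E = Module.finrank ℝ V ∧
  (E.restrictScalars ℝ) ⊓ ((E.restrictScalars ℝ).map (conjP V)) = ⊥

end Pairing

section Induced

variable {V : Type*} [AddCommGroup V] [Module ℝ V]

/-- The complexified inclusion `W_ℂ → V_ℂ` of a real subspace `W ⊆ V`. -/
noncomputable def cxIncl (W : Submodule ℝ V) : Cxf ↥W →ₗ[ℂ] Cxf V :=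
  LinearMap.baseChange ℂ W.subtype

/-- The subspace `E_W ⊆ W_ℂ ⊕ W_ℂ*` induced by `E ⊆ V_ℂ ⊕ V_ℂ*`:
`E_W = {(w, f|_{W_ℂ}) : (w, f) ∈ E, w ∈ W_ℂ}`. -/
noncomputable def inducedSub (E : Submodule ℂ (Cxf V × Module.Dual ℂ (Cxf V)))
    (W : Submodule ℝ V) : Submodule ℂ (Cxf ↥W × Module.Dual ℂ (Cxf ↥W)) :=
  (E.comap ((cxIncl W).prodMap (LinearMap.id))).map
    ((LinearMap.id).prodMap ((cxIncl W).dualMap))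

/-- `W` is a generalized complex subspace if `E_W ∩ Ē_W = 0`. -/
noncomputable def IsGCSubspace [FiniteDimensional ℝ V]
    (E : Submodule ℂ (Cxf V × Module.Dual ℂ (Cxf V))) (W : Submodule ℝ V) : Prop :=
  ((inducedSub E W).restrictScalars ℝ) ⊓
    (((inducedSub E W).restrictScalars ℝ).map (conjP ↥W)) = ⊥

end Induced

section Conjugation

variable {V : Type*} [AddCommGroup V] [Module ℝ V]

lemma conjC_conjC (x : Cxf V) : conjC V (conjC V x) = x := by
  induction x using TensorProduct.induction_on with
  | zero => simp
  | tmul a v => simp [conjC]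
  | add x y hx hy => simp [hx, hy]

lemma conjD_apply (f : Module.Dual ℂ (Cxf V)) (x : Cxf V) :
    conjD V f x = starRingEnd ℂ (f (conjC V x)) := rfl

lemma conjC_cxIncl (W : Submodule ℝ V) (x : Cxf ↥W) :
    conjC V (cxIncl W x) = cxIncl W (conjC ↥W x) := by
  induction x using TensorProduct.induction_on with
  | zero => simp
  | tmul a v => simp [conjC, cxIncl]
  | add x y hx hy => simp [hx, hy]

lemma conjD_comp_cxIncl (W : Submodule ℝ V) (f : Module.Dual ℂ (Cxf V)) :
    conjD ↥W (f ∘ₗ cxIncl W) = conjD V f ∘ₗ cxIncl W := by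
  refine LinearMap.ext fun x => ?_
  simp [conjD_apply, conjC_cxIncl]

/-- The complex conjugate of a complex subspace of `V_ℂ`. -/
noncomputable def conjSubmodule (A : Submodule ℂ (Cxf V)) : Submodule ℂ (Cxf V) where
  carrier := {x | conjC V x ∈ A}
  add_mem' {x y} hx hy := by simpa using A.add_mem hx hy
  zero_mem' := by simp
  smul_mem' c x hx := by simpa [conjC_smul] using A.smul_mem _ hx

lemma mem_conjSubmodule {A : Submodule ℂ (Cxf V)} {x : Cxf V} :
    x ∈ conjSubmodule A ↔ conjC V x ∈ A := Iff.rfl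

lemma conjD_mem_dualAnnihilator {A : Submodule ℂ (Cxf V)} {f : Module.Dual ℂ (Cxf V)}
    (hf : f ∈ (conjSubmodule A).dualAnnihilator) : conjD V f ∈ A.dualAnnihilator := by
  rw [Submodule.mem_dualAnnihilator] at hf ⊢
  intro x hx
  rw [conjD_apply, hf _ (by rwa [mem_conjSubmodule, conjC_conjC]), map_zero]

lemma coe_map_fst_map_conjP (E : Submodule ℂ (Cxf V × Module.Dual ℂ (Cxf V))) :
    (((E.restrictScalars ℝ).map (conjP V)).map
        ((LinearMap.fst ℂ (Cxf V) (Module.Dual ℂ (Cxf V))).restrictScalars ℝ) : Set (Cxf V)) =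
      conjSubmodule (E.map (LinearMap.fst ℂ (Cxf V) (Module.Dual ℂ (Cxf V)))) := by
  ext x
  simp only [SetLike.mem_coe, mem_conjSubmodule, Submodule.mem_map]
  constructor
  · rintro ⟨_, ⟨e, he, rfl⟩, rfl⟩
    exact ⟨e, he, (conjC_conjC e.1).symm⟩
  · rintro ⟨e, he, hx⟩
    refine ⟨_, ⟨e, he, rfl⟩, ?_⟩
    change conjC V e.1 = x
    rw [show e.1 = conjC V x from hx, conjC_conjC]

end Conjugation

section RealSubspaces

variable {V : Type*} [AddCommGroup V] [Module ℝ V]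

lemma one_tmul_mem_range_cxIncl {W : Submodule ℝ V} {v : V} :
    (1 : ℂ) ⊗ₜ[ℝ] v ∈ LinearMap.range (cxIncl W) ↔ v ∈ W := by
  constructor
  · rintro ⟨x, hx⟩
    have key : LinearMap.baseChange ℂ W.mkQ (cxIncl W x) = 0 := by
      rw [cxIncl, ← LinearMap.comp_apply, ← LinearMap.baseChange_comp]
      have : W.mkQ ∘ₗ W.subtype = 0 := by ext; simp
      simp [this]
    rw [hx, LinearMap.baseChange_tmul] at key
    rw [← Submodule.Quotient.mk_eq_zero]
    exact Module.FaithfullyFlat.tensorProduct_mk_injective (A := ℝ) (B := ℂ) _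
      (by simpa using key)
  · intro hv
    exact ⟨1 ⊗ₜ ⟨v, hv⟩, by simp [cxIncl]⟩

lemma cxIncl_injective (W : Submodule ℝ V) : Function.Injective (cxIncl W) :=
  Module.Flat.lTensor_preserves_injective_linearMap (M := ℂ) W.subtype W.injective_subtype

lemma mem_inducedSub {E : Submodule ℂ (Cxf V × Module.Dual ℂ (Cxf V))} {W : Submodule ℝ V}
    {x : Cxf ↥W × Module.Dual ℂ (Cxf ↥W)} :
    x ∈ inducedSub E W ↔ ∃ f, (cxIncl W x.1, f) ∈ E ∧ f ∘ₗ cxIncl W = x.2 := by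
  constructor
  · rintro ⟨⟨w, f⟩, he, rfl⟩
    exact ⟨f, he, rfl⟩
  · rintro ⟨f, he, hx⟩
    exact ⟨(x.1, f), he, Prod.ext rfl hx⟩

end RealSubspaces

section Annihilators

variable {V : Type*} [AddCommGroup V] [Module ℝ V] [FiniteDimensional ℝ V]
  {E : Submodule ℂ (Cxf V × Module.Dual ℂ (Cxf V))}

lemma IsGCSSub.mem_dualAnnihilator (hE : IsGCSSub V E) {a : Module.Dual ℂ (Cxf V)}
    (ha : (0, a) ∈ E) :
    a ∈ (E.map (LinearMap.fst ℂ (Cxf V) (Module.Dual ℂ (Cxf V)))).dualAnnihilator := by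
  rw [Submodule.mem_dualAnnihilator]
  rintro _ ⟨e, he, rfl⟩
  simpa [gcPairC] using hE.1 _ ha e he

/-- `E ∩ V_ℂ*` is the annihilator of `ρ(E)`. -/
lemma IsGCSSub.zero_prod_mem_iff (hE : IsGCSSub V E) {a : Module.Dual ℂ (Cxf V)} :
    (0, a) ∈ E ↔
      a ∈ (E.map (LinearMap.fst ℂ (Cxf V) (Module.Dual ℂ (Cxf V)))).dualAnnihilator := by
  refine ⟨hE.mem_dualAnnihilator, fun ha => ?_⟩
  set A := E.map (LinearMap.fst ℂ (Cxf V) (Module.Dual ℂ (Cxf V)))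
  let p := (LinearMap.fst ℂ (Cxf V) (Module.Dual ℂ (Cxf V))).domRestrict E
  let q := ((LinearMap.snd ℂ (Cxf V) (Module.Dual ℂ (Cxf V))).domRestrict E).domRestrict
    (LinearMap.ker p)
  have hker (x : LinearMap.ker p) : x.1.1 = (0, q x) := Prod.ext x.2 rfl
  have hq : Function.Injective q := fun x y h =>
    Subtype.ext (Subtype.ext (by rw [hker, hker, h]))
  have hle : LinearMap.range q ≤ A.dualAnnihilator := by
    rintro _ ⟨x, rfl⟩
    exact hE.mem_dualAnnihilator (hker x ▸ x.1.2)
  have hp : LinearMap.range p = A := by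
    rw [LinearMap.range_domRestrict]
  have hrank := p.finrank_range_add_finrank_ker
  have hann := Subspace.finrank_add_finrank_dualAnnihilator_eq A
  rw [Module.finrank_baseChange] at hann
  rw [hp, hE.2.1, ← LinearMap.finrank_range_of_inj hq] at hrank
  rw [← Submodule.eq_of_le_of_finrank_eq hle (by omega)] at ha
  obtain ⟨x, rfl⟩ := ha
  exact hker x ▸ x.1.2

/-- A subspace `W` with `E_W ∩ W_ℂ* = 0` satisfies `W_ℂ ⊆ ρ(E)`. -/
lemma IsGCSSub.range_cxIncl_le (hE : IsGCSSub V E) {W : Submodule ℝ V}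
    (hW : inducedSub E W ⊓
      Submodule.prod (⊥ : Submodule ℂ (Cxf ↥W)) (⊤ : Submodule ℂ (Module.Dual ℂ (Cxf ↥W))) = ⊥) :
    LinearMap.range (cxIncl W) ≤ E.map (LinearMap.fst ℂ (Cxf V) (Module.Dual ℂ (Cxf V))) := by
  set A := E.map (LinearMap.fst ℂ (Cxf V) (Module.Dual ℂ (Cxf V)))
  suffices h : (LinearMap.range (cxIncl W) ⊓ A).dualAnnihilator ≤
      (LinearMap.range (cxIncl W)).dualAnnihilator from
    (Subspace.dualAnnihilator_le_dualAnnihilator_iff.1 h).trans inf_le_right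
  rw [Subspace.dualAnnihilator_inf_eq]
  refine sup_le le_rfl fun b hb => ?_
  have hmem : ((0, b ∘ₗ cxIncl W) : Cxf ↥W × Module.Dual ℂ (Cxf ↥W)) ∈ inducedSub E W ⊓
      Submodule.prod (⊥ : Submodule ℂ (Cxf ↥W)) (⊤ : Submodule ℂ (Module.Dual ℂ (Cxf ↥W))) :=
    ⟨mem_inducedSub.2 ⟨b, by simpa using hE.zero_prod_mem_iff.2 hb, rfl⟩, by simp⟩
  rw [hW, Submodule.mem_bot] at hmem
  rw [Submodule.mem_dualAnnihilator]
  rintro _ ⟨x, rfl⟩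
  exact LinearMap.congr_fun (congrArg Prod.snd hmem) x

end Annihilators

/-- The canonical maximal B-symplectic subspace. `S_ℂ = ρ(E) ∩ ρ(Ē)`:
(i) `S` is a GC subspace; (ii) the induced structure `E_S` satisfies
`E_S ∩ S_ℂ* = 0` (it is B-symplectic); (iii) any GC subspace `W` whose induced
structure is B-symplectic is contained in `S`. -/
theorem maximal_bSymplectic_subspace
    (V : Type*) [AddCommGroup V] [Module ℝ V] [FiniteDimensional ℝ V]
    (E : Submodule ℂ (Cxf V × Module.Dual ℂ (Cxf V))) (hE : IsGCSSub V E)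
    (S : Submodule ℝ V)
    (hS : (LinearMap.range (cxIncl S) : Set (Cxf V)) =
        (E.map (LinearMap.fst ℂ (Cxf V) (Module.Dual ℂ (Cxf V))) : Set (Cxf V)) ∩
        (((E.restrictScalars ℝ).map (conjP V)).map
            ((LinearMap.fst ℂ (Cxf V) (Module.Dual ℂ (Cxf V))).restrictScalars ℝ) :
          Set (Cxf V))) :
    IsGCSubspace E S ∧
    (inducedSub E S ⊓
        Submodule.prod (⊥ : Submodule ℂ (Cxf ↥S)) (⊤ : Submodule ℂ (Module.Dual ℂ (Cxf ↥S)))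
      = ⊥) ∧
    (∀ W : Submodule ℝ V, IsGCSubspace E W →
      (inducedSub E W ⊓
          Submodule.prod (⊥ : Submodule ℂ (Cxf ↥W)) (⊤ : Submodule ℂ (Module.Dual ℂ (Cxf ↥W)))
        = ⊥) → W ≤ S) := by
  set A := E.map (LinearMap.fst ℂ (Cxf V) (Module.Dual ℂ (Cxf V)))
  have hSA : LinearMap.range (cxIncl S) = A ⊓ conjSubmodule A := by
    rw [coe_map_fst_map_conjP] at hS
    exact SetLike.coe_injective hS
  have hvanish {f : Module.Dual ℂ (Cxf V)} (hf : (0, f) ∈ E) : f ∘ₗ cxIncl S = 0 := by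
    refine LinearMap.ext fun x => ?_
    have hx : cxIncl S x ∈ A ⊓ conjSubmodule A := hSA ▸ LinearMap.mem_range_self _ x
    exact (Submodule.mem_dualAnnihilator _).1 (hE.zero_prod_mem_iff.1 hf) _ hx.1
  refine ⟨?_, ?_, fun W _ hW => ?_⟩
  · rw [IsGCSubspace, eq_bot_iff]
    rintro ⟨w, g⟩ ⟨h₁, ⟨⟨w', g'⟩, h₂, h₃⟩⟩
    obtain ⟨f₁, he₁, rfl⟩ := mem_inducedSub.1 h₁
    obtain ⟨f₂, he₂, rfl⟩ := mem_inducedSub.1 h₂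
    obtain rfl : conjC S w' = w := congrArg Prod.fst h₃
    have hres : conjD S (f₂ ∘ₗ cxIncl S) = f₁ ∘ₗ cxIncl S := congrArg Prod.snd h₃
    rw [conjD_comp_cxIncl] at hres
    have hdiff : f₁ - conjD V f₂ ∈ (LinearMap.range (cxIncl S)).dualAnnihilator := by
      rw [Submodule.mem_dualAnnihilator]
      rintro _ ⟨x, rfl⟩
      simpa [sub_eq_zero] using (LinearMap.congr_fun hres x).symm
    rw [hSA, Subspace.dualAnnihilator_inf_eq, Submodule.mem_sup] at hdiff
    obtain ⟨a, ha, b, hb, hab⟩ := hdiff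
    have ha := hE.zero_prod_mem_iff.2 ha
    have hb := hE.zero_prod_mem_iff.2 (conjD_mem_dualAnnihilator hb)
    have hmem : (cxIncl S (conjC S w'), f₁ - a) ∈
        E.restrictScalars ℝ ⊓ (E.restrictScalars ℝ).map (conjP V) := by
      refine ⟨by simpa using E.sub_mem he₁ ha, ⟨_, E.add_mem he₂ hb, ?_⟩⟩
      refine Prod.ext (by simp [conjP, conjC_cxIncl]) ?_
      have hbb : conjD V (conjD V b) = b :=
        LinearMap.ext fun x => by simp [conjD_apply, conjC_conjC]
      change conjD V (f₂ + conjD V b) = f₁ - a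
      rw [map_add, hbb, eq_sub_iff_add_eq, add_assoc, add_comm b, hab]
      abel
    rw [hE.2.2, Submodule.mem_bot, Prod.mk_eq_zero, sub_eq_zero] at hmem
    obtain ⟨hw, rfl⟩ := hmem
    rw [Submodule.mem_bot, Prod.mk_eq_zero]
    exact ⟨cxIncl_injective S (by simpa using hw), hvanish ha⟩
  · rw [eq_bot_iff]
    rintro ⟨w, g⟩ ⟨h₁, h₂, -⟩
    obtain rfl : w = 0 := h₂
    obtain ⟨f, he, rfl⟩ := mem_inducedSub.1 h₁
    rw [Submodule.mem_bot, Prod.mk_eq_zero]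
    exact ⟨rfl, hvanish (by simpa using he)⟩
  · intro v hv
    have hv' : (1 : ℂ) ⊗ₜ[ℝ] v ∈ A :=
      hE.range_cxIncl_le hW (one_tmul_mem_range_cxIncl.2 hv)
    rw [← one_tmul_mem_range_cxIncl, hSA]
    exact ⟨hv', by simpa [mem_conjSubmodule, conjC] using hv'⟩
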